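/- Let Λ be a row-finite locally convex k-graph and {s_λ : λ ∈ Λ} a Cuntz–Krieger Λ-family in a C*-algebra A. Let τ : A → ℂ be a linear functional satisfying τ(ab) = τ(ba) for all a,b ∈ A, and suppose τ(s_μ s_ν*) = 0 whenever μ,ν ∈ Λ satisfy d(μ) ≠ d(ν). Then for all μ,ν ∈ Λ one has τ(s_μ s_ν*) = δ_{μ,ν} τ(p_{s(μ)}), i.e. τ(s_μ s_ν*) = 0 if μ ≠ ν and τ(s_μ s_μ*) = τ(p_{s(μ)}). -/

import Mathlib

open scoped BigOperators ENNReal NNReal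

/-- A `k`-graph: a countable small category `Λ` together with a degree functor
`d : Λ → ℕ^k` satisfying the factorisation property.  Objects are identified with
the identity morphisms, i.e. the paths of degree `0`. -/
structure KGraph (k : ℕ) where
  /-- The morphisms ("paths") of the category. -/
  Path : Type
  countable : Countable Path
  /-- The degree functor. -/
  d : Path → Fin k → ℕ
  /-- The range (codomain) of a path, as an identity morphism. -/
  r : Path → Path
  /-- The source (domain) of a path, as an identity morphism. -/
  s : Path → Path
  /-- Composition `μν` of paths with `s μ = r ν`. -/
  comp : (μ ν : Path) → s μ = r ν → Path
  d_r : ∀ lam : Path, d (r lam) = 0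
  d_s : ∀ lam : Path, d (s lam) = 0
  /-- Paths of degree zero are identity morphisms, identified with their range. -/
  vertex_r : ∀ v : Path, d v = 0 → r v = v
  vertex_s : ∀ v : Path, d v = 0 → s v = v
  r_comp : ∀ (μ ν : Path) (h : s μ = r ν), r (comp μ ν h) = r μ
  s_comp : ∀ (μ ν : Path) (h : s μ = r ν), s (comp μ ν h) = s ν
  d_comp : ∀ (μ ν : Path) (h : s μ = r ν), d (comp μ ν h) = d μ + d ν
  comp_assoc : ∀ (lam μ ν : Path) (h₁ : s lam = r μ) (h₂ : s μ = r ν)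
      (h₃ : s (comp lam μ h₁) = r ν) (h₄ : s lam = r (comp μ ν h₂)),
      comp (comp lam μ h₁) ν h₃ = comp lam (comp μ ν h₂) h₄
  id_comp : ∀ (lam : Path) (h : s (r lam) = r lam), comp (r lam) lam h = lam
  comp_id : ∀ (lam : Path) (h : s lam = r (s lam)), comp lam (s lam) h = lam
  /-- The factorisation property. -/
  factor : ∀ (lam : Path) (m n : Fin k → ℕ), d lam = m + n →
      ∃! p : Path × Path, ∃ h : s p.1 = r p.2,
        d p.1 = m ∧ d p.2 = n ∧ comp p.1 p.2 h = lam

namespace KGraph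

variable {k : ℕ} (Λ : KGraph k)

/-- A vertex is a path of degree `0`. -/
def IsVertex (v : Λ.Path) : Prop := Λ.d v = 0

/-- The set `vΛⁿ` of paths of degree `n` with range `v`. -/
def paths (v : Λ.Path) (n : Fin k → ℕ) : Set Λ.Path :=
  {lam | Λ.d lam = n ∧ Λ.r lam = v}

/-- The set `Λⁿv` of paths of degree `n` with source `v`. -/
def pathsTo (v : Λ.Path) (n : Fin k → ℕ) : Set Λ.Path :=
  {lam | Λ.d lam = n ∧ Λ.s lam = v}

/-- The set `Λ^{≤ n}`. -/
def lePaths (n : Fin k → ℕ) : Set Λ.Path :=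
  {lam | Λ.d lam ≤ n ∧
    ∀ (μ : Λ.Path) (_ : Λ.s lam = Λ.r μ), Λ.d lam + Λ.d μ ≤ n → μ = Λ.s lam}

/-- The set `vΛ^{≤ n}`. -/
def vLePaths (v : Λ.Path) (n : Fin k → ℕ) : Set Λ.Path :=
  {lam | lam ∈ Λ.lePaths n ∧ Λ.r lam = v}

/-- `Λ` is row-finite if each `vΛⁿ` is finite. -/
def RowFinite : Prop := ∀ (v : Λ.Path) (n : Fin k → ℕ), (Λ.paths v n).Finite

/-- `Λ` is locally finite if it is row-finite and each `Λⁿv` is finite. -/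
def LocallyFinite : Prop :=
  Λ.RowFinite ∧ ∀ (v : Λ.Path) (n : Fin k → ℕ), (Λ.pathsTo v n).Finite

/-- `Λ` has no sinks if each `Λⁿv` is nonempty. -/
def NoSinks : Prop :=
  ∀ (v : Λ.Path), Λ.IsVertex v → ∀ n : Fin k → ℕ, (Λ.pathsTo v n).Nonempty

/-- `Λ` has no sources if each `vΛⁿ` is nonempty. -/
def NoSources : Prop :=
  ∀ (v : Λ.Path), Λ.IsVertex v → ∀ n : Fin k → ℕ, (Λ.paths v n).Nonempty

/-- `Λ` is locally convex. -/
def LocallyConvex : Prop :=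
  ∀ (i j : Fin k), i ≠ j → ∀ e : Λ.Path, Λ.d e = Pi.single i 1 →
    Λ.paths (Λ.s e) (Pi.single j 1) = ∅ → Λ.paths (Λ.r e) (Pi.single j 1) = ∅

/-- A `k`-graph trace on `Λ`: a function `g : Λ⁰ → [0,∞)` (extended arbitrarily to
all paths) with `g v = Σ_{λ ∈ vΛ^{≤n}} g (s λ)` for every vertex `v` and `n ∈ ℕ^k`. -/
def IsGraphTrace (g : Λ.Path → ℝ) : Prop :=
  (∀ v : Λ.Path, Λ.IsVertex v → 0 ≤ g v) ∧
  ∀ (v : Λ.Path), Λ.IsVertex v → ∀ (n : Fin k → ℕ) (F : Finset Λ.Path),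
    ↑F = Λ.vLePaths v n → g v = ∑ lam ∈ F, g (Λ.s lam)

/-- Two paths are orthogonal if they have no common extension. -/
def Orthogonal (μ ν : Λ.Path) : Prop :=
  ¬ ∃ (α β : Λ.Path) (h₁ : Λ.s μ = Λ.r α) (h₂ : Λ.s ν = Λ.r β),
      Λ.comp μ α h₁ = Λ.comp ν β h₂

end KGraph

/-- A boundary path of degree `m ∈ (ℕ ∪ {∞})^k` in a `k`-graph `Λ`. -/
structure KGraph.BoundaryPath {k : ℕ} (Λ : KGraph k) where
  /-- The degree of the boundary path. -/
  deg : Fin k → ℕ∞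
  /-- The segment `x(p,q)` for `p ≤ q ≤ deg`. -/
  seg : (Fin k → ℕ) → (Fin k → ℕ) → Λ.Path
  seg_d : ∀ p q : Fin k → ℕ, p ≤ q → (∀ i, (q i : ℕ∞) ≤ deg i) →
    Λ.d (seg p q) = q - p
  seg_r : ∀ p q : Fin k → ℕ, p ≤ q → (∀ i, (q i : ℕ∞) ≤ deg i) →
    Λ.r (seg p q) = seg p p
  seg_s : ∀ p q : Fin k → ℕ, p ≤ q → (∀ i, (q i : ℕ∞) ≤ deg i) →
    Λ.s (seg p q) = seg q q
  seg_comp : ∀ p q t : Fin k → ℕ, p ≤ q → q ≤ t → (∀ i, (t i : ℕ∞) ≤ deg i) →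
    ∀ h : Λ.s (seg p q) = Λ.r (seg q t), Λ.comp (seg p q) (seg q t) h = seg p t
  boundary : ∀ (i : Fin k) (n : Fin k → ℕ), (∀ j, (n j : ℕ∞) ≤ deg j) →
    (n i : ℕ∞) = deg i → Λ.paths (seg n n) (Pi.single i 1) = ∅

namespace KGraph

variable {k : ℕ} (Λ : KGraph k)

/-- An end of `Λ`: a boundary path `x` with `r(x)Λⁿ = {x(0,n)}` for all `n ≤ d(x)`. -/
def IsEnd (x : Λ.BoundaryPath) : Prop :=
  ∀ n : Fin k → ℕ, (∀ i, (n i : ℕ∞) ≤ x.deg i) →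
    Λ.paths (x.seg 0 0) n = {x.seg 0 n}

/-- A vertex `v` lies on the boundary path `x` if `v = x(n)` for some `n ≤ d(x)`. -/
def LiesOn (v : Λ.Path) (x : Λ.BoundaryPath) : Prop :=
  ∃ n : Fin k → ℕ, (∀ i, (n i : ℕ∞) ≤ x.deg i) ∧ v = x.seg n n

/-- Two ends are equivalent if they pass through a common vertex. -/
def EndEquiv (x y : Λ.BoundaryPath) : Prop :=
  ∃ (n m : Fin k → ℕ), (∀ i, (n i : ℕ∞) ≤ x.deg i) ∧ (∀ i, (m i : ℕ∞) ≤ y.deg i) ∧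
    x.seg n n = y.seg m m

end KGraph

/-- A Cuntz–Krieger `Λ`-family in a `C*`-algebra `A`. -/
structure CKFamily {k : ℕ} (Λ : KGraph k) (A : Type*) [NormedRing A] [StarRing A] where
  /-- The partial isometries `s_λ`. -/
  S : Λ.Path → A
  partial_isom : ∀ lam : Λ.Path, S lam * star (S lam) * S lam = S lam
  vertex_star : ∀ v : Λ.Path, Λ.IsVertex v → star (S v) = S v
  vertex_idem : ∀ v : Λ.Path, Λ.IsVertex v → S v * S v = S v
  vertex_orth : ∀ v w : Λ.Path, Λ.IsVertex v → Λ.IsVertex w → v ≠ w → S v * S w = 0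
  comp_mul : ∀ (μ ν : Λ.Path) (h : Λ.s μ = Λ.r ν), S μ * S ν = S (Λ.comp μ ν h)
  star_mul_self : ∀ lam : Λ.Path, star (S lam) * S lam = S (Λ.s lam)
  cuntz_krieger : ∀ (v : Λ.Path), Λ.IsVertex v → ∀ (n : Fin k → ℕ) (F : Finset Λ.Path),
    ↑F = Λ.vLePaths v n → S v = ∑ lam ∈ F, S lam * star (S lam)

/-- A trace on a `C*`-algebra `A`: a map `τ : A⁺ → [0,∞]` (extended arbitrarily to `A`)
which is additive and positively homogeneous on the positive cone and tracial. -/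
structure CstarTrace (A : Type*) [NormedRing A] [StarRing A] [PartialOrder A]
    [Module ℝ A] where
  /-- The underlying map. -/
  τ : A → ℝ≥0∞
  map_add : ∀ a b : A, 0 ≤ a → 0 ≤ b → τ (a + b) = τ a + τ b
  map_smul : ∀ (c : ℝ) (a : A), 0 ≤ c → 0 ≤ a → τ (c • a) = ENNReal.ofReal c * τ a
  tracial : ∀ a : A, τ (star a * a) = τ (a * star a)
variable {A : Type*} [NormedRing A] [StarRing A] [CStarRing A] [NormedAlgebra ℂ A]
  [StarModule ℂ A] [CompleteSpace A] [PartialOrder A] [StarOrderedRing A]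

namespace KGraph

variable {k : ℕ} {Λ : KGraph k}

theorem RowFinite.finite_vLePaths (h : Λ.RowFinite) (v : Λ.Path) (n : Fin k → ℕ) :
    (Λ.vLePaths v n).Finite :=
  ((Set.finite_Iic n).biUnion fun m _ => h v m).subset fun lam hlam =>
    Set.mem_biUnion (show Λ.d lam ∈ Set.Iic n from hlam.1.1) ⟨rfl, hlam.2⟩

theorem mem_vLePaths_of_d_eq {lam : Λ.Path} {n : Fin k → ℕ} (h : Λ.d lam = n) :
    lam ∈ Λ.vLePaths (Λ.r lam) n := by
  refine ⟨⟨h.le, fun μ hμ hle => ?_⟩, rfl⟩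
  have hd : Λ.d μ = 0 := by
    funext i
    have := hle i
    simp only [h, Pi.add_apply] at this
    simp only [Pi.zero_apply]
    omega
  rw [hμ, Λ.vertex_r μ hd]

end KGraph

namespace CKFamily

variable {k : ℕ} {Λ : KGraph k}

theorem S_r_mul {B : Type*} [NormedRing B] [StarRing B]
    (ck : CKFamily Λ B) (μ : Λ.Path) : ck.S (Λ.r μ) * ck.S μ = ck.S μ := by
  have h : Λ.s (Λ.r μ) = Λ.r μ := Λ.vertex_s _ (Λ.d_r μ)
  rw [ck.comp_mul _ _ h, Λ.id_comp μ h]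

theorem star_mul_eq_zero_of_r_ne {B : Type*} [NormedRing B] [StarRing B]
    (ck : CKFamily Λ B) {μ ν : Λ.Path} (h : Λ.r ν ≠ Λ.r μ) :
    star (ck.S ν) * ck.S μ = 0 := by
  rw [← ck.S_r_mul μ, ← ck.S_r_mul ν, star_mul, ck.vertex_star _ (Λ.d_r ν), mul_assoc,
    ← mul_assoc (ck.S (Λ.r ν)), ck.vertex_orth _ _ (Λ.d_r ν) (Λ.d_r μ) h, zero_mul, mul_zero]

/-- Distinct paths in `vΛ^{≤n}` have orthogonal range projections. -/
theorem star_mul_eq_zero_of_mem_vLePaths (ck : CKFamily Λ A) (hrf : Λ.RowFinite)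
    {v : Λ.Path} (hv : Λ.IsVertex v) {n : Fin k → ℕ} {μ ν : Λ.Path} (hμ : μ ∈ Λ.vLePaths v n)
    (hν : ν ∈ Λ.vLePaths v n) (hne : μ ≠ ν) : star (ck.S ν) * ck.S μ = 0 := by
  classical
  have hfin := hrf.finite_vLePaths v n
  have hck := ck.cuntz_krieger v hv n hfin.toFinset hfin.coe_toFinset
  have hpμ : ck.S v * ck.S μ = ck.S μ := hμ.2 ▸ ck.S_r_mul μ
  have hsum : ∑ lam ∈ hfin.toFinset.erase μ,
      star (star (ck.S lam) * ck.S μ) * (star (ck.S lam) * ck.S μ) = 0 := by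
    have key : star (ck.S μ) * (ck.S v * ck.S μ) = star (ck.S μ) * ck.S μ := by rw [hpμ]
    rw [hck, ← Finset.add_sum_erase _ _ (hfin.mem_toFinset.2 hμ), add_mul, mul_add,
      ck.partial_isom, add_eq_left, Finset.sum_mul, Finset.mul_sum] at key
    simpa only [star_mul, star_star, mul_assoc] using key
  have hzero := (Finset.sum_eq_zero_iff_of_nonneg fun lam _ =>
    star_mul_self_nonneg (star (ck.S lam) * ck.S μ)).1 hsum ν
      (Finset.mem_erase.2 ⟨hne.symm, hfin.mem_toFinset.2 hν⟩)
  exact (CStarRing.star_mul_self_eq_zero_iff _).1 hzero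

theorem star_mul_eq_zero_of_d_eq (ck : CKFamily Λ A) (hrf : Λ.RowFinite) {μ ν : Λ.Path}
    (hd : Λ.d μ = Λ.d ν) (hne : μ ≠ ν) : star (ck.S ν) * ck.S μ = 0 := by
  by_cases hr : Λ.r ν = Λ.r μ
  · exact ck.star_mul_eq_zero_of_mem_vLePaths hrf (Λ.d_r μ) (KGraph.mem_vLePaths_of_d_eq hd)
      (hr ▸ KGraph.mem_vLePaths_of_d_eq rfl) hne
  · exact ck.star_mul_eq_zero_of_r_ne hr

end CKFamily

/-- A tracial linear functional on `A` which kills `s_μ s_ν*` whenever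
`d(μ) ≠ d(ν)` satisfies `τ(s_μ s_ν*) = δ_{μ,ν} τ(p_{s(μ)})`. -/
theorem gauge_invariant_trace_diagonal
    {k : ℕ} (Λ : KGraph k) (hrf : Λ.RowFinite) (hlc : Λ.LocallyConvex)
    (ck : CKFamily Λ A) (τ : A →ₗ[ℂ] ℂ)
    (htracial : ∀ a b : A, τ (a * b) = τ (b * a))
    (hgauge : ∀ μ ν : Λ.Path, Λ.d μ ≠ Λ.d ν → τ (ck.S μ * star (ck.S ν)) = 0) :
    ∀ μ ν : Λ.Path,
      (μ ≠ ν → τ (ck.S μ * star (ck.S ν)) = 0) ∧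
      τ (ck.S μ * star (ck.S μ)) = τ (ck.S (Λ.s μ)) := by
  intro μ ν
  refine ⟨fun hne => ?_, by rw [htracial, ck.star_mul_self]⟩
  by_cases hd : Λ.d μ = Λ.d ν
  · rw [htracial, ck.star_mul_eq_zero_of_d_eq hrf hd hne, map_zero]
  · exact hgauge μ ν hd
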